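/- Let n, m ≥ 2 and let r ∈ ℝ^n, c ∈ ℝ^m have strictly positive entries and equal total sums. The TBP map is injective, with the explicit inverse from the paper's proof: if TBP(t) = X, then for every 1 ≤ i ≤ n−1 and 1 ≤ j ≤ m−1 one has t_{ij} = σ^{−1}((x_{ij} − L_{ij}) / (U_{ij} − L_{ij})), where L_{ij} and U_{ij} are the bounds computed by the TBP construction from the budgets determined by the entries of X visited before position (i,j) (namely, current row budget rᵢ − Σ_{k<j} x_{ik} and current column budget cⱼ − Σ_{k<i} x_{kj}), and σ^{−1} is the inverse of the logistic sigmoid. -/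

import Mathlib

/-- The logistic sigmoid `σ(x) = 1 / (1 + e^{-x})`. -/
noncomputable def sigmoid (x : ℝ) : ℝ := 1 / (1 + Real.exp (-x))

/-- Entries of the matrix produced by the TBP (North-West corner) construction,
with `ℕ`-indexed margins `r`, `c` and parameters `t`.  Positions `(i,j)` with
`i < n-1`, `j < m-1` get `L + (U - L) · σ(t i j)` where `L`, `U` are computed from
the current remaining budgets; the last column of each row gets the remaining row
budget, and the last row gets the remaining column budgets. -/
noncomputable def tbpEntry (n m : ℕ) (r c : ℕ → ℝ) (t : ℕ → ℕ → ℝ) : ℕ → ℕ → ℝ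
  | i, j =>
    if i = n - 1 then
      -- the last row is filled with the remaining column budgets
      c j - ∑ k ∈ (Finset.range i).attach, tbpEntry n m r c t k.1 j
    else if j = m - 1 then
      -- the last entry of each row is the remaining row budget
      r i - ∑ k ∈ (Finset.range j).attach, tbpEntry n m r c t i k.1
    else
      let rowB := r i - ∑ k ∈ (Finset.range j).attach, tbpEntry n m r c t i k.1
      let colB := c j - ∑ k ∈ (Finset.range i).attach, tbpEntry n m r c t k.1 j
      let colTail := ∑ k ∈ Finset.Ico (j + 1) m,
        (c k - ∑ l ∈ (Finset.range i).attach, tbpEntry n m r c t l.1 k)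
      let rowTail := ∑ k ∈ Finset.Ico (i + 1) n, r k
      let L := max 0 (max (rowB - colTail) (colB - rowTail))
      let U := min rowB colB
      L + (U - L) * sigmoid (t i j)
termination_by i j => (i, j)
decreasing_by
  all_goals
    first
    | exact Prod.Lex.left _ _ (Finset.mem_range.mp k.2)
    | exact Prod.Lex.right _ (Finset.mem_range.mp k.2)
    | exact Prod.Lex.left _ _ (Finset.mem_range.mp l.2)

/-- Extend a `Fin n`-indexed vector to `ℕ` by zero. -/
def extFin {n : ℕ} (r : Fin n → ℝ) : ℕ → ℝ :=
  fun i => if h : i < n then r ⟨i, h⟩ else 0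

/-- Extend a doubly `Fin`-indexed array to `ℕ × ℕ` by zero. -/
def extFin2 {n m : ℕ} (t : Fin n → Fin m → ℝ) : ℕ → ℕ → ℝ :=
  fun i j => if h : i < n then (if h' : j < m then t ⟨i, h⟩ ⟨j, h'⟩ else 0) else 0

/-- The transportation polytope `T(r,c)`: real `n × m` matrices with nonnegative
entries, row sums `r` and column sums `c`. -/
def transportPolytope (n m : ℕ) (r : Fin n → ℝ) (c : Fin m → ℝ) :
    Set (Matrix (Fin n) (Fin m) ℝ) :=
  {X | (∀ i j, 0 ≤ X i j) ∧ (∀ i, ∑ j, X i j = r i) ∧ (∀ j, ∑ i, X i j = c j)}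

/-- The TBP map `Φ : ℝ^{(n-1)×(m-1)} → ℝ^{n×m}`. -/
noncomputable def tbpMap (n m : ℕ) (r : Fin n → ℝ) (c : Fin m → ℝ)
    (t : Fin (n - 1) → Fin (m - 1) → ℝ) : Matrix (Fin n) (Fin m) ℝ :=
  Matrix.of fun i j => tbpEntry n m (extFin r) (extFin c) (extFin2 t) i j

/-- Current remaining row budget at position `(i,j)` for a matrix `X`:
`r i` minus the entries of row `i` already placed (columns `< j`). -/
noncomputable def rowBudget (r : ℕ → ℝ) (X : ℕ → ℕ → ℝ) (i j : ℕ) : ℝ :=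
  r i - ∑ k ∈ Finset.range j, X i k

/-- Current remaining column budget at position `(i,j)` for a matrix `X`:
`c j` minus the entries of column `j` already placed (rows `< i`). -/
noncomputable def colBudget (c : ℕ → ℝ) (X : ℕ → ℕ → ℝ) (i j : ℕ) : ℝ :=
  c j - ∑ k ∈ Finset.range i, X k j

/-- The lower bound `L_{ij} = max(0, rᵢ − Σ_{k>j} c_k, cⱼ − Σ_{k>i} r_k)` computed
from the current remaining budgets determined by the entries of `X` visited before
position `(i,j)`. -/
noncomputable def tbpL (n m : ℕ) (r c : ℕ → ℝ) (X : ℕ → ℕ → ℝ) (i j : ℕ) : ℝ :=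
  max 0 (max (rowBudget r X i j - ∑ k ∈ Finset.Ico (j + 1) m, colBudget c X i k)
             (colBudget c X i j - ∑ k ∈ Finset.Ico (i + 1) n, r k))

/-- The upper bound `U_{ij} = min(rᵢ, cⱼ)` computed from the current budgets. -/
noncomputable def tbpU (r c : ℕ → ℝ) (X : ℕ → ℕ → ℝ) (i j : ℕ) : ℝ :=
  min (rowBudget r X i j) (colBudget c X i j)

/-- The inverse `σ⁻¹` of the logistic sigmoid (the logit function). -/
noncomputable def logit (y : ℝ) : ℝ := Real.log (y / (1 - y))

theorem sigmoid_pos (x : ℝ) : 0 < sigmoid x := by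
  unfold sigmoid
  positivity

theorem sigmoid_lt_one (x : ℝ) : sigmoid x < 1 := by
  unfold sigmoid
  rw [div_lt_one (by positivity)]
  linarith [Real.exp_pos (-x)]

theorem logit_sigmoid (x : ℝ) : logit (sigmoid x) = x := by
  have h : sigmoid x / (1 - sigmoid x) = Real.exp x := by
    have h1 : Real.exp x * Real.exp (-x) = 1 := by rw [← Real.exp_add]; simp
    have h2 : 1 - sigmoid x ≠ 0 := (sub_pos.mpr (sigmoid_lt_one x)).ne'
    have h3 : 1 + Real.exp (-x) ≠ 0 := by positivity
    rw [div_eq_iff h2]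
    unfold sigmoid
    field_simp
    linarith
  rw [logit, h, Real.log_exp]

theorem rowBudget_succ (r : ℕ → ℝ) (X : ℕ → ℕ → ℝ) (i j : ℕ) :
    rowBudget r X i (j + 1) = rowBudget r X i j - X i j := by
  simp only [rowBudget, Finset.sum_range_succ]
  ring

theorem colBudget_succ (c : ℕ → ℝ) (X : ℕ → ℕ → ℝ) (i j : ℕ) :
    colBudget c X (i + 1) j = colBudget c X i j - X i j := by
  simp only [colBudget, Finset.sum_range_succ]
  ring

theorem rowBudget_congr {m : ℕ} (r : ℕ → ℝ) {X Y : ℕ → ℕ → ℝ} {i j : ℕ} (hj : j ≤ m)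
    (h : ∀ l < m, X i l = Y i l) : rowBudget r X i j = rowBudget r Y i j := by
  unfold rowBudget
  congr 1
  exact Finset.sum_congr rfl fun l hl => h l (by rw [Finset.mem_range] at hl; omega)

theorem colBudget_congr {n : ℕ} (c : ℕ → ℝ) {X Y : ℕ → ℕ → ℝ} {i j : ℕ} (hi : i ≤ n)
    (h : ∀ k < n, X k j = Y k j) : colBudget c X i j = colBudget c Y i j := by
  unfold colBudget
  congr 1
  exact Finset.sum_congr rfl fun k hk => h k (by rw [Finset.mem_range] at hk; omega)

theorem tbpL_congr {n m : ℕ} (r c : ℕ → ℝ) {X Y : ℕ → ℕ → ℝ} {i j : ℕ} (hi : i < n)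
    (hj : j < m) (h : ∀ k < n, ∀ l < m, X k l = Y k l) :
    tbpL n m r c X i j = tbpL n m r c Y i j := by
  unfold tbpL
  rw [rowBudget_congr r hj.le (h i hi), colBudget_congr c hi.le fun k hk => h k hk j hj,
    Finset.sum_congr rfl fun l hl =>
      colBudget_congr c hi.le fun k hk => h k hk l (Finset.mem_Ico.mp hl).2]

theorem tbpU_congr {n m : ℕ} (r c : ℕ → ℝ) {X Y : ℕ → ℕ → ℝ} {i j : ℕ} (hi : i < n)
    (hj : j < m) (h : ∀ k < n, ∀ l < m, X k l = Y k l) :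
    tbpU r c X i j = tbpU r c Y i j := by
  unfold tbpU
  rw [rowBudget_congr r hj.le (h i hi), colBudget_congr c hi.le fun k hk => h k hk j hj]

theorem tbpEntry_interior {n m : ℕ} (r c : ℕ → ℝ) (t : ℕ → ℕ → ℝ) {i j : ℕ}
    (hi : i + 1 < n) (hj : j + 1 < m) :
    tbpEntry n m r c t i j = tbpL n m r c (tbpEntry n m r c t) i j +
      (tbpU r c (tbpEntry n m r c t) i j - tbpL n m r c (tbpEntry n m r c t) i j) *
        sigmoid (t i j) := by
  conv_lhs => rw [tbpEntry]
  rw [if_neg (by omega), if_neg (by omega)]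
  have hcol (l : ℕ) := Finset.sum_attach (Finset.range i) fun k => tbpEntry n m r c t k l
  have hrow := Finset.sum_attach (Finset.range j) fun l => tbpEntry n m r c t i l
  simp only [tbpL, tbpU, rowBudget, colBudget, hcol, hrow]

theorem tbpEntry_last_col {n m : ℕ} (r c : ℕ → ℝ) (t : ℕ → ℕ → ℝ) {i : ℕ}
    (hi : i + 1 < n) :
    tbpEntry n m r c t i (m - 1) = rowBudget r (tbpEntry n m r c t) i (m - 1) := by
  conv_lhs => rw [tbpEntry]
  rw [if_neg (by omega), if_pos rfl]
  simp only [rowBudget, Finset.sum_attach _ fun k => tbpEntry n m r c t i k]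

/-- The columns are feasible for rows `i, …, n - 1`: all their budgets are positive and they
sum up to the total of the remaining rows. -/
def ColFeasible (n m : ℕ) (r c : ℕ → ℝ) (X : ℕ → ℕ → ℝ) (i : ℕ) : Prop :=
  (∀ k < m, 0 < colBudget c X i k) ∧
    ∑ k ∈ Finset.range m, colBudget c X i k = ∑ k ∈ Finset.Ico i n, r k

/-- Row `i` is feasible from column `j` on: its budget is positive and smaller than the total
budget of the remaining columns, and the columns already visited keep a positive budget. -/
def RowFeasible (m : ℕ) (r c : ℕ → ℝ) (X : ℕ → ℕ → ℝ) (i j : ℕ) : Prop :=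
  0 < rowBudget r X i j ∧
    rowBudget r X i j < ∑ k ∈ Finset.Ico j m, colBudget c X i k ∧
    ∀ k < j, 0 < colBudget c X (i + 1) k

section Feasibility

variable {n m : ℕ} {r c : ℕ → ℝ} {X : ℕ → ℕ → ℝ} {i j : ℕ}

theorem ColFeasible.rowFeasible_zero (hr : ∀ k < n, 0 < r k) (hi : i + 1 < n)
    (h : ColFeasible n m r c X i) : RowFeasible m r c X i 0 := by
  refine ⟨by simpa [rowBudget] using hr i (by omega), ?_, by simp⟩
  have hpos : 0 < ∑ k ∈ Finset.Ico (i + 1) n, r k :=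
    Finset.sum_pos (fun k hk => hr k (Finset.mem_Ico.mp hk).2) ⟨i + 1, by simpa using hi⟩
  rw [Nat.Ico_zero_eq_range, h.2, Finset.sum_eq_sum_Ico_succ_bot (by omega : i < n)]
  simpa [rowBudget] using hpos

theorem tbpL_lt_tbpU (hr : ∀ k < n, 0 < r k) (hi : i + 1 < n) (hj : j + 1 < m)
    (h : ColFeasible n m r c X i) (h' : RowFeasible m r c X i j) :
    tbpL n m r c X i j < tbpU r c X i j := by
  obtain ⟨hcol, hsum⟩ := h
  obtain ⟨hrow, hlt, hvis⟩ := h'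
  have hbj := hcol j (by omega)
  have hrows : 0 < ∑ k ∈ Finset.Ico (i + 1) n, r k :=
    Finset.sum_pos (fun k hk => hr k (Finset.mem_Ico.mp hk).2) ⟨i + 1, by simpa using hi⟩
  have hcols : 0 < ∑ k ∈ Finset.Ico (j + 1) m, colBudget c X i k :=
    Finset.sum_pos (fun k hk => hcol k (Finset.mem_Ico.mp hk).2) ⟨j + 1, by simpa using hj⟩
  rw [Finset.sum_eq_sum_Ico_succ_bot (by omega : j < m)] at hlt
  have hvisited : 0 ≤ ∑ k ∈ Finset.range j, colBudget c X (i + 1) k :=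
    Finset.sum_nonneg fun k hk => (hvis k (Finset.mem_range.mp hk)).le
  rw [← Finset.sum_range_add_sum_Ico _ (by omega : j ≤ m),
    Finset.sum_eq_sum_Ico_succ_bot (by omega : j < m),
    Finset.sum_eq_sum_Ico_succ_bot (by omega : i < n)] at hsum
  simp only [colBudget_succ, Finset.sum_sub_distrib] at hvisited
  have hbudget : rowBudget r X i j = r i - ∑ k ∈ Finset.range j, X i k := rfl
  refine max_lt (lt_min hrow hbj) (max_lt (lt_min ?_ ?_) (lt_min ?_ ?_)) <;> linarith

theorem RowFeasible.succ (h' : RowFeasible m r c X i j) (hj : j < m)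
    (hL : tbpL n m r c X i j < X i j) (hU : X i j < tbpU r c X i j) :
    RowFeasible m r c X i (j + 1) := by
  obtain ⟨-, -, hvis⟩ := h'
  obtain ⟨-, h2⟩ := max_lt_iff.mp hL
  obtain ⟨h2, -⟩ := max_lt_iff.mp h2
  obtain ⟨h3, h4⟩ := lt_min_iff.mp hU
  refine ⟨?_, ?_, fun k hk => ?_⟩
  · rw [rowBudget_succ]; linarith
  · rw [rowBudget_succ]; linarith
  · rcases Nat.lt_succ_iff_lt_or_eq.mp hk with hk | rfl
    · exact hvis k hk
    · rw [colBudget_succ]; linarith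

theorem RowFeasible.colFeasible_succ (hm : 1 ≤ m) (hi : i < n)
    (h : ColFeasible n m r c X i) (h' : RowFeasible m r c X i (m - 1))
    (hlast : X i (m - 1) = rowBudget r X i (m - 1)) : ColFeasible n m r c X (i + 1) := by
  obtain ⟨m, rfl⟩ := Nat.exists_eq_add_of_le' hm
  rw [Nat.add_sub_cancel] at h' hlast
  obtain ⟨-, hlt, hvis⟩ := h'
  rw [Nat.Ico_succ_singleton, Finset.sum_singleton] at hlt
  refine ⟨fun k hk => ?_, ?_⟩
  · rcases Nat.lt_succ_iff_lt_or_eq.mp hk with hk | rfl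
    · exact hvis k hk
    · rw [colBudget_succ]; linarith
  · have hsum := h.2
    rw [Finset.sum_eq_sum_Ico_succ_bot hi] at hsum
    have hrow : ∑ k ∈ Finset.range (m + 1), X i k = r i := by
      rw [Finset.sum_range_succ, hlast, rowBudget]
      ring
    simp only [colBudget_succ, Finset.sum_sub_distrib]
    linarith

end Feasibility

section Bounds

variable {n m : ℕ} {r c : ℕ → ℝ} {t : ℕ → ℕ → ℝ} {i : ℕ}

theorem tbpEntry_rowFeasible (hr : ∀ k < n, 0 < r k) (hi : i + 1 < n)
    (h : ColFeasible n m r c (tbpEntry n m r c t) i) {j : ℕ} (hj : j < m) :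
    RowFeasible m r c (tbpEntry n m r c t) i j := by
  induction j with
  | zero => exact h.rowFeasible_zero hr hi
  | succ j ih =>
    have hrow := ih (by omega)
    have hlt := sub_pos.mpr (tbpL_lt_tbpU hr hi hj h hrow)
    have hentry := tbpEntry_interior r c t hi hj
    have hpos := mul_pos hlt (sigmoid_pos (t i j))
    have hlt' := mul_lt_mul_of_pos_left (sigmoid_lt_one (t i j)) hlt
    exact hrow.succ (n := n) (by omega) (by linarith) (by linarith)

theorem tbpEntry_colFeasible (hm : 1 ≤ m) (hr : ∀ k < n, 0 < r k) (hc : ∀ k < m, 0 < c k)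
    (hbal : ∑ k ∈ Finset.range n, r k = ∑ k ∈ Finset.range m, c k) (hi : i < n) :
    ColFeasible n m r c (tbpEntry n m r c t) i := by
  induction i with
  | zero => exact ⟨by simpa [colBudget] using hc, by simp [colBudget, hbal]⟩
  | succ i ih =>
    have h := ih (by omega)
    exact (tbpEntry_rowFeasible hr hi h (by omega)).colFeasible_succ hm (by omega) h
      (tbpEntry_last_col r c t hi)

theorem logit_tbpEntry (hr : ∀ k < n, 0 < r k) (hc : ∀ k < m, 0 < c k)
    (hbal : ∑ k ∈ Finset.range n, r k = ∑ k ∈ Finset.range m, c k) {j : ℕ}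
    (hi : i + 1 < n) (hj : j + 1 < m) :
    logit ((tbpEntry n m r c t i j - tbpL n m r c (tbpEntry n m r c t) i j) /
      (tbpU r c (tbpEntry n m r c t) i j - tbpL n m r c (tbpEntry n m r c t) i j)) =
        t i j := by
  have h := tbpEntry_colFeasible (t := t) (by omega) hr hc hbal (by omega : i < n)
  have hlt := tbpL_lt_tbpU hr hi hj h (tbpEntry_rowFeasible hr hi h (by omega))
  rw [sub_eq_of_eq_add' (tbpEntry_interior r c t hi hj),
    mul_div_cancel_left₀ _ (sub_pos.mpr hlt).ne', logit_sigmoid]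

end Bounds

theorem extFin_pos {n : ℕ} {r : Fin n → ℝ} (hr : ∀ i, 0 < r i) :
    ∀ k < n, 0 < extFin r k := by
  intro k hk
  simpa [extFin, hk] using hr ⟨k, hk⟩

theorem sum_range_extFin {n : ℕ} (r : Fin n → ℝ) :
    ∑ k ∈ Finset.range n, extFin r k = ∑ i, r i := by
  rw [Finset.sum_range]
  simp [extFin]

theorem eq_logit_tbpMap {n m : ℕ} {r : Fin n → ℝ} {c : Fin m → ℝ}
    (hr : ∀ i, 0 < r i) (hc : ∀ j, 0 < c j) (hbal : ∑ i, r i = ∑ j, c j)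
    (t : Fin (n - 1) → Fin (m - 1) → ℝ) (i : Fin (n - 1)) (j : Fin (m - 1)) :
    t i j =
      logit ((tbpMap n m r c t (Fin.castLE (by omega) i) (Fin.castLE (by omega) j) -
          tbpL n m (extFin r) (extFin c) (extFin2 (fun a b => tbpMap n m r c t a b)) i.1 j.1) /
        (tbpU (extFin r) (extFin c) (extFin2 (fun a b => tbpMap n m r c t a b)) i.1 j.1 -
          tbpL n m (extFin r) (extFin c)
            (extFin2 (fun a b => tbpMap n m r c t a b)) i.1 j.1)) := by
  have hi : i.1 + 1 < n := by omega
  have hj : j.1 + 1 < m := by omega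
  have hX : ∀ k < n, ∀ l < m, extFin2 (fun a b => tbpMap n m r c t a b) k l =
      tbpEntry n m (extFin r) (extFin c) (extFin2 t) k l := by
    intro k hk l hl
    simp [extFin2, hk, hl, tbpMap]
  rw [tbpL_congr _ _ (by omega) (by omega) hX, tbpU_congr _ _ (by omega) (by omega) hX]
  refine Eq.trans ?_ (logit_tbpEntry (t := extFin2 t) (extFin_pos hr) (extFin_pos hc)
    (by rw [sum_range_extFin, sum_range_extFin, hbal]) hi hj).symm
  simp [extFin2]

/-- For `n, m ≥ 2` and strictly positive margins with equal total
sums, the TBP map is injective, with the explicit inverse of the paper's proof: if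
`TBP(t) = X` then `t_{ij} = σ⁻¹((x_{ij} − L_{ij}) / (U_{ij} − L_{ij}))`, where `L_{ij}`
and `U_{ij}` are computed from the budgets determined by the entries of `X` visited
before position `(i,j)`. -/
theorem tbp_injective_explicit_inverse (n m : ℕ) (hn : 2 ≤ n) (hm : 2 ≤ m)
    (r : Fin n → ℝ) (c : Fin m → ℝ)
    (hr : ∀ i, 0 < r i) (hc : ∀ j, 0 < c j)
    (hbal : ∑ i, r i = ∑ j, c j) :
    Function.Injective (tbpMap n m r c) ∧
    ∀ (t : Fin (n - 1) → Fin (m - 1) → ℝ) (X : Matrix (Fin n) (Fin m) ℝ),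
      tbpMap n m r c t = X →
      ∀ (i : Fin (n - 1)) (j : Fin (m - 1)),
        t i j =
          logit ((X (Fin.castLE (by omega) i) (Fin.castLE (by omega) j) -
              tbpL n m (extFin r) (extFin c) (extFin2 (fun a b => X a b)) i.1 j.1) /
            (tbpU (extFin r) (extFin c) (extFin2 (fun a b => X a b)) i.1 j.1 -
              tbpL n m (extFin r) (extFin c) (extFin2 (fun a b => X a b)) i.1 j.1)) := by
  refine ⟨fun t t' h => ?_, ?_⟩
  · funext i j
    rw [eq_logit_tbpMap hr hc hbal t, eq_logit_tbpMap hr hc hbal t', h]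
  · rintro t X rfl i j
    exact eq_logit_tbpMap hr hc hbal t i j
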